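/- (Theorem 2.1, Euler case.) Let n ≥ 1 and 1 < γ ≤ 1 + 2/n. Suppose M(0) ∈ (0,∞), ℙ(0) ≠ 0, F(0), G(0) are finite, E(0) ∈ (0,∞), and the initial data satisfy E(0)^{n(γ−1)/2} · J(0) / (exp(s₁/c_ν) M(0)^{((n+2)γ−n)/2}) < (Γ(n/2+1)/π^{n/2})^{γ−1} / (2^{((n+2)γ−n)/2}(γ−1)), where J(0) = G(0) − F(0) + E(0) and s₁ = min_x s(x,0). Then there exists a finite time T₁* > 0, determined by M(0), F(0), G(0), E(0), s₁, c_ν, γ and n, such that no classical solution of the full compressible Euler equations with these initial physical quantities, satisfying the decay, integrability and entropy conditions, can exist on ℝⁿ × [0, T₁*]; in particular there is no such global-in-time solution. -/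

import Mathlib

open MeasureTheory Filter
open scoped InnerProductSpace

noncomputable section

/-- A classical solution of the full compressible Euler equations for a polytropic gas
with pressure `p = exp(s/c_ν) ρ^γ`:
`∂ₜρ + div(ρu) = 0`, `∂ₜ(ρuᵢ) + div(ρuᵢu) + ∂ᵢp = 0`,
`∂ₜ((1/2)ρ|u|² + p/(γ−1)) + div(((1/2)ρ|u|² + γp/(γ−1))u) = 0` on `ℝⁿ × [0,T]`,
together with the decay conditions (9-25), the entropy lower bound `s ≥ s₁`, the
integrability conditions on the physical quantities, and differentiability of these
quantities with derivatives computed by differentiating under the integral sign. -/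
structure FullEulerSolution (n : ℕ) (γ cν s₁ T : ℝ) where
  ρ : ℝ → EuclideanSpace ℝ (Fin n) → ℝ
  u : ℝ → EuclideanSpace ℝ (Fin n) → EuclideanSpace ℝ (Fin n)
  s : ℝ → EuclideanSpace ℝ (Fin n) → ℝ
  ρ_nonneg : ∀ t ∈ Set.Icc 0 T, ∀ x, 0 ≤ ρ t x
  /-- the entropy condition: `s(x,t) ≥ s₁ = min_x s(x,0)`. -/
  entropy_lb : ∀ t ∈ Set.Icc 0 T, ∀ x, s₁ ≤ s t x
  smooth_ρ : ContDiffOn ℝ 1 (fun p : ℝ × EuclideanSpace ℝ (Fin n) => ρ p.1 p.2)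
    (Set.Icc 0 T ×ˢ Set.univ)
  smooth_u : ContDiffOn ℝ 1 (fun p : ℝ × EuclideanSpace ℝ (Fin n) => u p.1 p.2)
    (Set.Icc 0 T ×ˢ Set.univ)
  smooth_s : ContDiffOn ℝ 1 (fun p : ℝ × EuclideanSpace ℝ (Fin n) => s p.1 p.2)
    (Set.Icc 0 T ×ˢ Set.univ)
  /-- Conservation of mass: `∂ₜρ + div(ρu) = 0`. -/
  mass_eq : ∀ t ∈ Set.Icc 0 T, ∀ x,
    deriv (fun τ => ρ τ x) t
      + ∑ i : Fin n, fderiv ℝ (fun y => ρ t y * u t y i) x (EuclideanSpace.single i 1) = 0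
  /-- Conservation of momentum: `∂ₜ(ρuᵢ) + div(ρuᵢu) + ∂ᵢp = 0`. -/
  momentum_eq : ∀ t ∈ Set.Icc 0 T, ∀ x, ∀ i : Fin n,
    deriv (fun τ => ρ τ x * u τ x i) t
      + ∑ j : Fin n, fderiv ℝ (fun y => ρ t y * u t y i * u t y j) x (EuclideanSpace.single j 1)
      + fderiv ℝ (fun y => Real.exp (s t y / cν) * ρ t y ^ γ) x (EuclideanSpace.single i 1)
      = 0
  /-- Conservation of energy:
  `∂ₜ((1/2)ρ|u|² + p/(γ−1)) + div(((1/2)ρ|u|² + γp/(γ−1))u) = 0`. -/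
  energy_eq : ∀ t ∈ Set.Icc 0 T, ∀ x,
    deriv (fun τ => (1 / 2 : ℝ) * ρ τ x * ‖u τ x‖ ^ 2
        + Real.exp (s τ x / cν) * ρ τ x ^ γ / (γ - 1)) t
      + ∑ i : Fin n, fderiv ℝ (fun y => ((1 / 2 : ℝ) * ρ t y * ‖u t y‖ ^ 2
          + γ * (Real.exp (s t y / cν) * ρ t y ^ γ) / (γ - 1)) * u t y i) x
          (EuclideanSpace.single i 1) = 0
  /-- decay: `|u| → 0` as `|x| → ∞`. -/
  decay_u : ∀ t ∈ Set.Icc 0 T,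
    Tendsto (fun x => ‖u t x‖) (Bornology.cobounded _) (nhds 0)
  /-- decay: `ρ|u| = o(|x|^{-(n+1)})`. -/
  decay_ρu : ∀ t ∈ Set.Icc 0 T,
    Tendsto (fun x => ‖x‖ ^ (n + 1) * (ρ t x * ‖u t x‖)) (Bornology.cobounded _) (nhds 0)
  /-- decay: `|∇ₓu| = o(|x|^{-n})`. -/
  decay_gradu : ∀ t ∈ Set.Icc 0 T,
    Tendsto (fun x => ‖x‖ ^ n * ‖fderiv ℝ (u t) x‖) (Bornology.cobounded _) (nhds 0)
  /-- decay: the pressure `p = o(|x|^{-n})`. -/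
  decay_p : ∀ t ∈ Set.Icc 0 T,
    Tendsto (fun x => ‖x‖ ^ n * (Real.exp (s t x / cν) * ρ t x ^ γ))
      (Bornology.cobounded _) (nhds 0)
  int_ρ : ∀ t ∈ Set.Icc 0 T, Integrable (ρ t)
  int_ρu : ∀ t ∈ Set.Icc 0 T, Integrable (fun x => ρ t x * ‖u t x‖)
  int_ρu2 : ∀ t ∈ Set.Icc 0 T, Integrable (fun x => ρ t x * ‖u t x‖ ^ 2)
  int_ρx2 : ∀ t ∈ Set.Icc 0 T, Integrable (fun x => ρ t x * ‖x‖ ^ 2)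
  int_ρux : ∀ t ∈ Set.Icc 0 T, Integrable (fun x => ρ t x * ‖u t x‖ * ‖x‖)
  int_p : ∀ t ∈ Set.Icc 0 T, Integrable (fun x => Real.exp (s t x / cν) * ρ t x ^ γ)
  /-- `M(t) = ∫ρ` is differentiable, by differentiation under the integral sign. -/
  hM : ∀ t ∈ Set.Icc 0 T,
    HasDerivAt (fun τ => ∫ x, ρ τ x) (∫ x, deriv (fun τ => ρ τ x) t) t
  /-- `ℙ(t) = ∫ρu` is differentiable, by differentiation under the integral sign. -/
  hP : ∀ t ∈ Set.Icc 0 T,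
    HasDerivAt (fun τ => ∫ x, ρ τ x • u τ x) (∫ x, deriv (fun τ => ρ τ x • u τ x) t) t
  /-- `F(t) = ∫ρ u·x` is differentiable, by differentiation under the integral sign. -/
  hF : ∀ t ∈ Set.Icc 0 T,
    HasDerivAt (fun τ => ∫ x, ρ τ x * ⟪u τ x, x⟫_ℝ)
      (∫ x, deriv (fun τ => ρ τ x * ⟪u τ x, x⟫_ℝ) t) t
  /-- `G(t) = (1/2)∫ρ|x|²` is differentiable, by differentiation under the integral sign. -/
  hG : ∀ t ∈ Set.Icc 0 T,
    HasDerivAt (fun τ => (1 / 2 : ℝ) * ∫ x, ρ τ x * ‖x‖ ^ 2)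
      ((1 / 2 : ℝ) * ∫ x, deriv (fun τ => ρ τ x * ‖x‖ ^ 2) t) t
  /-- `E(t) = E_k(t) + E_i(t)` is differentiable, by differentiation under the integral
  sign. -/
  hE : ∀ t ∈ Set.Icc 0 T,
    HasDerivAt (fun τ => ∫ x, ((1 / 2 : ℝ) * ρ τ x * ‖u τ x‖ ^ 2
        + Real.exp (s τ x / cν) * ρ τ x ^ γ / (γ - 1)))
      (∫ x, deriv (fun τ => (1 / 2 : ℝ) * ρ τ x * ‖u τ x‖ ^ 2
        + Real.exp (s τ x / cν) * ρ τ x ^ γ / (γ - 1)) t) t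

namespace FullEulerSolution

variable {n : ℕ} {γ cν s₁ T : ℝ}

/-- The mass `M(t) = ∫ ρ dx`. -/
def M (S : FullEulerSolution n γ cν s₁ T) (t : ℝ) : ℝ := ∫ x, S.ρ t x

/-- The momentum `ℙ(t) = ∫ ρ u dx`. -/
def P (S : FullEulerSolution n γ cν s₁ T) (t : ℝ) : EuclideanSpace ℝ (Fin n) :=
  ∫ x, S.ρ t x • S.u t x

/-- The momentum weight `F(t) = ∫ ρ u·x dx`. -/
def F (S : FullEulerSolution n γ cν s₁ T) (t : ℝ) : ℝ := ∫ x, S.ρ t x * ⟪S.u t x, x⟫_ℝ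

/-- The momentum of inertia `G(t) = (1/2) ∫ ρ |x|² dx`. -/
def G (S : FullEulerSolution n γ cν s₁ T) (t : ℝ) : ℝ :=
  (1 / 2 : ℝ) * ∫ x, S.ρ t x * ‖x‖ ^ 2

/-- The kinetic energy `E_k(t) = (1/2) ∫ ρ |u|² dx`. -/
def Ek (S : FullEulerSolution n γ cν s₁ T) (t : ℝ) : ℝ :=
  (1 / 2 : ℝ) * ∫ x, S.ρ t x * ‖S.u t x‖ ^ 2

/-- The internal energy `E_i(t) = (1/(γ−1)) ∫ p dx` with `p = exp(s/c_ν) ρ^γ`. -/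
def Ei (S : FullEulerSolution n γ cν s₁ T) (t : ℝ) : ℝ :=
  (1 / (γ - 1)) * ∫ x, Real.exp (S.s t x / cν) * S.ρ t x ^ γ

/-- The total energy `E(t) = E_k(t) + E_i(t)`. -/
def E (S : FullEulerSolution n γ cν s₁ T) (t : ℝ) : ℝ := S.Ek t + S.Ei t

/-- The functional `J(t) = G(t) − (t+1)F(t) + (t+1)² E(t)`. -/
def J (S : FullEulerSolution n γ cν s₁ T) (t : ℝ) : ℝ :=
  S.G t - (t + 1) * S.F t + (t + 1) ^ 2 * S.E t

end FullEulerSolution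

/-- Smooth cutoffs `χ k` increasing to `1` with `|∇χ k| ≤ C / (1 + |x|)` uniformly in `k`. -/
theorem exists_cutoff_sequence (n : ℕ) :
    ∃ (C : ℝ) (χ : ℕ → EuclideanSpace ℝ (Fin n) → ℝ),
      (∀ k, ContDiff ℝ 1 (χ k)) ∧ (∀ k, HasCompactSupport (χ k)) ∧ (∀ k x, |χ k x| ≤ 1) ∧
      (∀ k x, (1 + ‖x‖) * ‖fderiv ℝ (χ k) x‖ ≤ C) ∧
      ∀ x, ∀ᶠ k in atTop, χ k x = 1 ∧ fderiv ℝ (χ k) x = 0 := by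
  let f : ContDiffBump (0 : EuclideanSpace ℝ (Fin n)) := ⟨1, 2, by norm_num, by norm_num⟩
  have hf : ContDiff ℝ 1 f := f.contDiff
  have hcont : Continuous (fun y : EuclideanSpace ℝ (Fin n) => (1 + ‖y‖) * ‖fderiv ℝ f y‖) :=
    (by fun_prop : Continuous fun y : EuclideanSpace ℝ (Fin n) => 1 + ‖y‖).mul
      (hf.continuous_fderiv (by norm_num)).norm
  obtain ⟨C, hC⟩ := HasCompactSupport.exists_bound_of_continuous
    (f.hasCompactSupport.fderiv (𝕜 := ℝ)).norm.mul_left hcont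
  have hpos : ∀ k : ℕ, (0 : ℝ) < (k : ℝ) + 1 := fun k => by positivity
  refine ⟨C, fun k x => f (((k : ℝ) + 1)⁻¹ • x), fun k => hf.comp (contDiff_const_smul _),
    fun k => f.hasCompactSupport.comp_smul (inv_ne_zero (hpos k).ne'), fun k x => ?_,
    fun k x => ?_, fun x => ?_⟩
  · rw [abs_of_nonneg f.nonneg]; exact f.le_one
  · rw [fderiv_comp_smul, norm_smul, Real.norm_of_nonneg (inv_nonneg.2 (hpos k).le)]
    refine le_trans ?_ ((le_abs_self _).trans (hC ((((k : ℝ) + 1)⁻¹) • x)))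
    rw [Pi.mul_apply, norm_smul, Real.norm_of_nonneg (inv_nonneg.2 (hpos k).le), ← mul_assoc]
    gcongr
    rw [add_mul, one_mul, mul_comm ‖x‖]
    gcongr
    exact inv_le_one_of_one_le₀ (by linarith [(Nat.cast_nonneg k : (0 : ℝ) ≤ k)])
  · filter_upwards [eventually_gt_atTop ⌈‖x‖⌉₊] with k hk
    have hk' : ‖x‖ < (k : ℝ) + 1 := by
      have := (Nat.le_ceil ‖x‖).trans_lt (Nat.cast_lt (α := ℝ).2 hk)
      linarith
    have hmem : ((k : ℝ) + 1)⁻¹ • x ∈ Metric.ball (0 : EuclideanSpace ℝ (Fin n)) 1 := by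
      rw [mem_ball_zero_iff, norm_smul, Real.norm_of_nonneg (inv_nonneg.2 (hpos k).le),
        inv_mul_lt_iff₀ (hpos k)]
      linarith
    refine ⟨f.one_of_mem_closedBall (Metric.ball_subset_closedBall hmem), ?_⟩
    rw [fderiv_comp_smul, (f.eventuallyEq_one_of_mem_ball hmem).fderiv_eq]
    simp [show (1 : EuclideanSpace ℝ (Fin n) → ℝ) = fun _ => 1 from rfl]

theorem Real.Gamma_add_one_le {a : ℝ} (ha : 0 < a) :
    Real.Gamma (a + 1) ≤ 2 * (2 * a / Real.exp 1) ^ a := by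
  rw [Real.Gamma_eq_integral (by linarith)]
  have hint : IntegrableOn (fun x : ℝ => Real.exp (-(1 / 2) * x)) (Set.Ioi 0) :=
    integrableOn_exp_mul_Ioi (by norm_num) 0
  have hval : ∫ x in Set.Ioi (0 : ℝ), Real.exp (-(1 / 2) * x) = 2 := by
    rw [integral_exp_mul_Ioi (by norm_num)]; norm_num
  calc ∫ x in Set.Ioi (0 : ℝ), Real.exp (-x) * x ^ (a + 1 - 1)
      ≤ ∫ x in Set.Ioi (0 : ℝ), (2 * a / Real.exp 1) ^ a * Real.exp (-(1 / 2) * x) := by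
        refine setIntegral_mono_on (Real.GammaIntegral_convergent (by linarith))
          (hint.const_mul _) measurableSet_Ioi fun x hx => ?_
        have hx : 0 < x := hx
        rw [Real.rpow_def_of_pos hx, Real.rpow_def_of_pos (by positivity), ← Real.exp_add,
          ← Real.exp_add, Real.exp_le_exp, Real.log_div (by positivity) (by positivity),
          Real.log_exp]
        have h := Real.log_le_sub_one_of_pos (show 0 < x / (2 * a) by positivity)
        rw [Real.log_div hx.ne' (by positivity)] at h
        have h' := mul_le_mul_of_nonneg_left h ha.le
        have : a * (x / (2 * a) - 1) = x / 2 - a := by field_simp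
        nlinarith
    _ = 2 * (2 * a / Real.exp 1) ^ a := by
        rw [integral_const_mul, hval, mul_comm]

/-- Lower bound for `∫ f ^ γ` in terms of the mass and the second moment of `f`. -/
theorem moment_mul_rpow_le_integral_rpow {n : ℕ} (hn : 1 ≤ n) {γ : ℝ} (hγ : 1 < γ)
    (hγn : γ ≤ 1 + 2 / n) {f : EuclideanSpace ℝ (Fin n) → ℝ} (hf0 : ∀ x, 0 ≤ f x)
    (hf : Integrable f) (hf2 : Integrable fun x => f x * ‖x‖ ^ 2)
    (hfγ : Integrable fun x => f x ^ γ) (hM : 0 < ∫ x, f x) {H : ℝ} (hH : 0 < H)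
    (hQ : ∫ x, f x * ‖x‖ ^ 2 ≤ 2 * H) :
    (∫ x, f x) ^ ((((n : ℝ) + 2) * γ - n) / 2)
        * (Real.Gamma ((n : ℝ) / 2 + 1) / Real.pi ^ ((n : ℝ) / 2)) ^ (γ - 1)
        / (2 : ℝ) ^ ((((n : ℝ) + 2) * γ - n) / 2)
      ≤ (∫ x, f x ^ γ) * H ^ ((n : ℝ) * (γ - 1) / 2) := by
  set M := ∫ x, f x with hMdef
  set I := ∫ x, f x ^ γ with hIdef
  have hn0 : (0 : ℝ) < n := by exact_mod_cast hn
  have hγ1 : 0 < γ - 1 := by linarith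
  have hγ0 : 0 < γ := by linarith
  have hconj : γ.HolderConjugate (γ / (γ - 1)) :=
    Real.HolderConjugate.conjExponent hγ
  have hq : 0 < γ / (γ - 1) := by positivity
  have hκ : 0 < n * (γ - 1) / 2 := by positivity
  set κ : ℝ := n * (γ - 1) / 2 with hκdef
  have hκ1 : κ ≤ 1 := by
    have : (γ - 1) * n ≤ 2 := by
      rw [← le_div_iff₀ hn0]; linarith
    rw [hκdef]; linarith
  -- The Gaussian weight `exp (-β |x|²)` with the optimal width.
  set β : ℝ := M * (κ / γ) / (2 * H) with hβdef
  have hβ : 0 < β := by positivity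
  have hgauss : ∀ {b : ℝ}, 0 < b →
      Integrable fun x : EuclideanSpace ℝ (Fin n) => Real.exp (-b * ‖x‖ ^ 2) := by
    intro b hb
    by_contra h
    have h1 := GaussianFourier.integral_rexp_neg_mul_sq_norm
      (V := EuclideanSpace ℝ (Fin n)) hb
    rw [integral_undef h] at h1
    exact (Real.rpow_pos_of_pos (div_pos Real.pi_pos hb) _).ne h1
  have hpow : ∀ x : EuclideanSpace ℝ (Fin n),
      Real.exp (-β * ‖x‖ ^ 2) ^ (γ / (γ - 1)) = Real.exp (-(β * (γ / (γ - 1))) * ‖x‖ ^ 2) := by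
    intro x
    rw [← Real.exp_mul]; ring_nf
  have hcont : Continuous fun x : EuclideanSpace ℝ (Fin n) => Real.exp (-β * ‖x‖ ^ 2) := by
    fun_prop
  have hmem1 : MemLp f (ENNReal.ofReal γ) := by
    rw [← integrable_norm_rpow_iff hf.1 (by simpa using hγ0) ENNReal.ofReal_ne_top,
      ENNReal.toReal_ofReal hγ0.le]
    simpa only [Real.norm_of_nonneg (hf0 _)] using hfγ
  have hmem2 : MemLp (fun x : EuclideanSpace ℝ (Fin n) => Real.exp (-β * ‖x‖ ^ 2))
      (ENNReal.ofReal (γ / (γ - 1))) := by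
    rw [← integrable_norm_rpow_iff hcont.aestronglyMeasurable (by simpa using hq)
      ENNReal.ofReal_ne_top, ENNReal.toReal_ofReal hq.le]
    simp only [Real.norm_of_nonneg (Real.exp_pos _).le, hpow]
    exact hgauss (by positivity)
  have holder := integral_mul_le_Lp_mul_Lq_of_nonneg hconj (Eventually.of_forall hf0)
    (Eventually.of_forall fun x => (Real.exp_pos _).le) hmem1 hmem2
  simp only [hpow] at holder
  rw [GaussianFourier.integral_rexp_neg_mul_sq_norm (by positivity),
    finrank_euclideanSpace_fin, ← hIdef] at holder
  have hfg : Integrable fun x => f x * Real.exp (-β * ‖x‖ ^ 2) := by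
    refine hf.mul_bdd (c := 1) hcont.aestronglyMeasurable (Eventually.of_forall fun x => ?_)
    rw [Real.norm_of_nonneg (Real.exp_pos _).le, Real.exp_le_one_iff]
    nlinarith [mul_nonneg hβ.le (sq_nonneg ‖x‖)]
  have hlow : Real.exp (-(κ / γ)) * M ≤ ∫ x, f x * Real.exp (-β * ‖x‖ ^ 2) := by
    calc Real.exp (-(κ / γ)) * M
        ≤ Real.exp (-(κ / γ)) * ((1 + κ / γ) * M - β * ∫ x, f x * ‖x‖ ^ 2) := by
          gcongr
          have h1 := mul_le_mul_of_nonneg_left hQ hβ.le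
          have h2 : β * (2 * H) = M * (κ / γ) := by rw [hβdef]; field_simp
          linarith
      _ = ∫ x, Real.exp (-(κ / γ)) * ((1 + κ / γ) * f x - β * (f x * ‖x‖ ^ 2)) := by
          rw [integral_const_mul, integral_sub (hf.const_mul _) (hf2.const_mul _),
            integral_const_mul, integral_const_mul]
      _ ≤ ∫ x, f x * Real.exp (-β * ‖x‖ ^ 2) := by
          refine integral_mono (((hf.const_mul _).sub (hf2.const_mul _)).const_mul _) hfg
            fun x => ?_
          have h1 := Real.add_one_le_exp (κ / γ - β * ‖x‖ ^ 2)
          have h2 : Real.exp (-β * ‖x‖ ^ 2)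
              = Real.exp (-(κ / γ)) * Real.exp (κ / γ - β * ‖x‖ ^ 2) := by
            rw [← Real.exp_add]; ring_nf
          rw [h2]
          calc _ = f x * (Real.exp (-(κ / γ)) * (κ / γ - β * ‖x‖ ^ 2 + 1)) := by ring
            _ ≤ _ := by gcongr; exact hf0 x
  have key := hlow.trans holder
  have hI : 0 < I := by
    refine lt_of_le_of_ne (integral_nonneg fun x => Real.rpow_nonneg (hf0 x) _) fun h => ?_
    rw [← h, Real.zero_rpow (by positivity), zero_mul] at key
    exact absurd key (not_le.2 (by positivity))
  have hΓ := Real.Gamma_add_one_le (show (0 : ℝ) < n / 2 by positivity)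
  have hΓ0 : 0 < Real.Gamma ((n : ℝ) / 2 + 1) := Real.Gamma_pos_of_pos (by positivity)
  have hqβ : β * (γ / (γ - 1)) = M * n / (4 * H) := by
    rw [hβdef, hκdef]; field_simp; ring
  rw [hqβ] at key
  have hpi := Real.pi_pos
  rw [← Real.log_le_log_iff (by positivity) (by positivity)] at key hΓ ⊢
  rw [show 2 * ((n : ℝ) / 2) / Real.exp 1 = n / Real.exp 1 by ring,
    Real.log_mul (by positivity) (by positivity), Real.log_rpow (by positivity),
    Real.log_div (by positivity) (by positivity), Real.log_exp] at hΓ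
  rw [Real.log_mul (by positivity) (by positivity), Real.log_exp,
    Real.log_mul (by positivity) (by positivity), Real.log_rpow hI,
    Real.log_rpow (by positivity), Real.log_rpow (by positivity),
    Real.log_div (by positivity) (by positivity), Real.log_div (by positivity) (by positivity),
    Real.log_mul (by positivity) (by positivity), Real.log_mul (by positivity) (by positivity),
    show (4 : ℝ) = 2 ^ 2 by norm_num, Real.log_pow] at key
  rw [Real.log_div (by positivity) (by positivity), Real.log_mul (by positivity) (by positivity),
    Real.log_mul (by positivity) (by positivity), Real.log_rpow hM, Real.log_rpow (by positivity),
    Real.log_rpow (by positivity), Real.log_rpow hH,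
    Real.log_div (by positivity) (by positivity), Real.log_rpow hpi]
  have hlog2 : 0 ≤ Real.log 2 := Real.log_nonneg (by norm_num)
  have e1 : (((n : ℝ) + 2) * γ - n) / 2 = γ + κ := by rw [hκdef]; ring
  have key' := mul_le_mul_of_nonneg_left key hγ0.le
  have hΓ' := mul_le_mul_of_nonneg_left hΓ hγ1.le
  have h3 : 0 ≤ (1 - κ) * Real.log 2 := mul_nonneg (by linarith) hlog2
  have e2 : (γ - 1) * (Real.log 2 + n / 2 * (Real.log n - 1))
      = (γ - 1) * Real.log 2 + κ * (Real.log n - 1) := by rw [hκdef]; ring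
  have e3 : (γ - 1) * (Real.log (Real.Gamma ((n : ℝ) / 2 + 1)) - n / 2 * Real.log Real.pi)
      = (γ - 1) * Real.log (Real.Gamma ((n : ℝ) / 2 + 1)) - κ * Real.log Real.pi := by
    rw [hκdef]; ring
  have e4 : ∀ X : ℝ, γ * (1 / γ * Real.log I + 1 / (γ / (γ - 1)) * ((n : ℝ) / 2 * X))
      = Real.log I + κ * X := by
    intro X; rw [hκdef]; field_simp
  have e5 : γ * (-(κ / γ) + Real.log M) = -κ + γ * Real.log M := by field_simp
  rw [e4, e5] at key'
  rw [e2] at hΓ'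
  rw [e1, e3]
  push_cast at key'
  linarith

/-- Truncations of a test function whose gradients are dominated by the growth rate `g`. -/
theorem exists_truncation {n : ℕ} {φ g : EuclideanSpace ℝ (Fin n) → ℝ} (hφ : ContDiff ℝ 1 φ)
    (hg : ∀ x, ‖fderiv ℝ φ x‖ ≤ g x) (hφg : ∀ x, |φ x| ≤ g x * (1 + ‖x‖)) :
    ∃ (C : ℝ) (ψ : ℕ → EuclideanSpace ℝ (Fin n) → ℝ),
      (∀ k, ContDiff ℝ 1 (ψ k)) ∧ (∀ k, HasCompactSupport (ψ k)) ∧ (∀ k x, |ψ k x| ≤ |φ x|) ∧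
      (∀ k x, ‖fderiv ℝ (ψ k) x‖ ≤ C * g x) ∧
      ∀ x, ∀ᶠ k in atTop, ψ k x = φ x ∧ fderiv ℝ (ψ k) x = fderiv ℝ φ x := by
  obtain ⟨C, χ, hχ, hχc, hχ1, hχ', hχlim⟩ := exists_cutoff_sequence n
  have hfd : ∀ k x, fderiv ℝ (fun y => φ y * χ k y) x
      = φ x • fderiv ℝ (χ k) x + χ k x • fderiv ℝ φ x := fun k x =>
    fderiv_fun_mul (hφ.differentiable (by norm_num) x) ((hχ k).differentiable (by norm_num) x)
  refine ⟨C + 1, fun k x => φ x * χ k x, fun k => hφ.mul (hχ k), fun k => (hχc k).mul_left,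
    fun k x => ?_, fun k x => ?_, fun x => ?_⟩
  · rw [abs_mul]
    exact mul_le_of_le_one_right (abs_nonneg _) (hχ1 k x)
  · rw [hfd]
    have hg0 : 0 ≤ g x := (norm_nonneg _).trans (hg x)
    calc _ ≤ |φ x| * ‖fderiv ℝ (χ k) x‖ + |χ k x| * ‖fderiv ℝ φ x‖ := by
          refine (norm_add_le _ _).trans_eq ?_
          rw [norm_smul, norm_smul, Real.norm_eq_abs, Real.norm_eq_abs]
      _ ≤ (g x * (1 + ‖x‖)) * ‖fderiv ℝ (χ k) x‖ + 1 * g x := by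
          gcongr
          exacts [hφg x, hχ1 k x, hg x]
      _ = g x * ((1 + ‖x‖) * ‖fderiv ℝ (χ k) x‖) + g x := by ring
      _ ≤ g x * C + g x := by gcongr; exact hχ' k x
      _ = (C + 1) * g x := by ring
  · filter_upwards [hχlim x] with k hk
    refine ⟨by simp [hk.1], ?_⟩
    rw [hfd, hk.1, hk.2]
    simp

theorem tendsto_integral_mul_of_truncation {n : ℕ} {φ d : EuclideanSpace ℝ (Fin n) → ℝ}
    {ψ : ℕ → EuclideanSpace ℝ (Fin n) → ℝ} (hψ : ∀ k, Continuous (ψ k))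
    (hψφ : ∀ k x, |ψ k x| ≤ |φ x|) (hlim : ∀ x, ∀ᶠ k in atTop, ψ k x = φ x)
    (hd : AEStronglyMeasurable d) (hφd : Integrable fun x => φ x * d x) :
    Tendsto (fun k => ∫ x, ψ k x * d x) atTop (nhds (∫ x, φ x * d x)) := by
  refine tendsto_integral_of_dominated_convergence (fun x => ‖φ x * d x‖)
    (fun k => (hψ k).aestronglyMeasurable.mul hd) hφd.norm
    (fun k => Eventually.of_forall fun x => ?_) (Eventually.of_forall fun x => ?_)
  · rw [norm_mul, norm_mul]
    exact mul_le_mul_of_nonneg_right (hψφ k x) (norm_nonneg _)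
  · exact tendsto_const_nhds.congr' ((hlim x).mono fun k hk => by simp only [hk])

theorem norm_apply_le_of_truncation {n : ℕ} {ψ g : EuclideanSpace ℝ (Fin n) → ℝ} {C : ℝ}
    (hψg : ∀ x, ‖fderiv ℝ ψ x‖ ≤ C * g x)
    (q : EuclideanSpace ℝ (Fin n) → EuclideanSpace ℝ (Fin n)) (x : EuclideanSpace ℝ (Fin n)) :
    ‖fderiv ℝ ψ x (q x)‖ ≤ C * (‖q x‖ * g x) :=
  ((fderiv ℝ ψ x).le_opNorm (q x)).trans <| by
    rw [mul_comm ‖q x‖, ← mul_assoc]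
    exact mul_le_mul_of_nonneg_right (hψg x) (norm_nonneg _)

theorem tendsto_integral_fderiv_of_truncation {n : ℕ} {φ g : EuclideanSpace ℝ (Fin n) → ℝ}
    {ψ : ℕ → EuclideanSpace ℝ (Fin n) → ℝ} {C : ℝ} (hψ : ∀ k, ContDiff ℝ 1 (ψ k))
    (hψg : ∀ k x, ‖fderiv ℝ (ψ k) x‖ ≤ C * g x)
    (hlim : ∀ x, ∀ᶠ k in atTop, fderiv ℝ (ψ k) x = fderiv ℝ φ x)
    {q : EuclideanSpace ℝ (Fin n) → EuclideanSpace ℝ (Fin n)} (hq : Continuous q)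
    (hqg : Integrable fun x => ‖q x‖ * g x) :
    Tendsto (fun k => ∫ x, fderiv ℝ (ψ k) x (q x)) atTop (nhds (∫ x, fderiv ℝ φ x (q x))) := by
  refine tendsto_integral_of_dominated_convergence (fun x => C * (‖q x‖ * g x))
    (fun k => (((hψ k).continuous_fderiv (by norm_num)).clm_apply hq).aestronglyMeasurable)
    (hqg.const_mul _)
    (fun k => Eventually.of_forall fun x => norm_apply_le_of_truncation (hψg k) q x)
    (Eventually.of_forall fun x => ?_)
  exact tendsto_const_nhds.congr' ((hlim x).mono fun k hk => by simp only [hk])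

/-- Integration by parts for a conservation law `d + div q = 0`. -/
theorem integral_mul_eq_integral_fderiv {n : ℕ} {d φ : EuclideanSpace ℝ (Fin n) → ℝ}
    {q : EuclideanSpace ℝ (Fin n) → EuclideanSpace ℝ (Fin n)} (hq : ContDiff ℝ 1 q)
    (hdq : ∀ x, d x + ∑ i : Fin n, fderiv ℝ (fun y => q y i) x (EuclideanSpace.single i 1) = 0)
    (hφ : ContDiff ℝ 1 φ) (hφc : HasCompactSupport φ) :
    ∫ x, φ x * d x = ∫ x, fderiv ℝ φ x (q x) := by
  have hqi : ∀ i, ContDiff ℝ 1 fun y => q y i := fun i => by fun_prop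
  have hcont : ∀ {h : EuclideanSpace ℝ (Fin n) → ℝ}, ContDiff ℝ 1 h → ∀ v,
      Continuous fun x => fderiv ℝ h x v := fun hh v =>
    (hh.continuous_fderiv (by norm_num)).clm_apply continuous_const
  have int1 : ∀ i, Integrable fun x =>
      φ x * fderiv ℝ (fun y => q y i) x (EuclideanSpace.single i 1) := fun i =>
    (hφ.continuous.mul (hcont (hqi i) _)).integrable_of_hasCompactSupport hφc.mul_right
  have int2 : ∀ i, Integrable fun x => fderiv ℝ φ x (EuclideanSpace.single i 1) * q x i :=
    fun i => ((hcont hφ _).mul (hqi i).continuous).integrable_of_hasCompactSupport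
      ((hφc.fderiv_apply (𝕜 := ℝ) _).mul_right)
  have int3 : ∀ i, Integrable fun x => φ x * q x i := fun i =>
    (hφ.continuous.mul (hqi i).continuous).integrable_of_hasCompactSupport hφc.mul_right
  have h1 : ∀ x, φ x * d x
      = -∑ i, φ x * fderiv ℝ (fun y => q y i) x (EuclideanSpace.single i 1) := by
    intro x
    rw [← Finset.mul_sum, eq_neg_of_add_eq_zero_left (hdq x), mul_neg]
  have h2 : ∀ x, fderiv ℝ φ x (q x)
      = ∑ i, fderiv ℝ φ x (EuclideanSpace.single i 1) * q x i := by
    intro x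
    conv_lhs => rw [← (EuclideanSpace.basisFun (Fin n) ℝ).sum_repr (q x)]
    simp [mul_comm]
  simp only [h1, h2]
  rw [integral_neg, integral_finsetSum _ fun i _ => int1 i,
    integral_finsetSum _ fun i _ => int2 i, ← Finset.sum_neg_distrib]
  refine Finset.sum_congr rfl fun i _ => ?_
  rw [integral_mul_fderiv_eq_neg_fderiv_mul_of_integrable (int2 i) (int1 i) (int3 i)
    (fun x _ => hφ.differentiable (by norm_num) x)
    (fun x _ => (hqi i).differentiable (by norm_num) x), neg_neg]

theorem integral_eq_zero_of_add_divergence_eq_zero {n : ℕ}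
    {d : EuclideanSpace ℝ (Fin n) → ℝ}
    {q : EuclideanSpace ℝ (Fin n) → EuclideanSpace ℝ (Fin n)} (hq : ContDiff ℝ 1 q)
    (hdq : ∀ x, d x + ∑ i : Fin n, fderiv ℝ (fun y => q y i) x (EuclideanSpace.single i 1) = 0)
    (hqint : Integrable q) : ∫ x, d x = 0 := by
  by_cases hd : Integrable d
  swap
  · exact integral_undef hd
  obtain ⟨C, ψ, hψ, hψc, hψφ, hψg, hlim⟩ := exists_truncation (n := n) (φ := fun _ => 1)
    (g := fun _ => 1) contDiff_const (fun x => by simp) (fun x => by simp)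
  have h1 := tendsto_integral_mul_of_truncation (fun k => (hψ k).continuous) hψφ
    (fun x => (hlim x).mono fun k hk => hk.1) hd.1 (by simpa using hd)
  have h2 := tendsto_integral_fderiv_of_truncation hψ hψg
    (fun x => (hlim x).mono fun k hk => hk.2) hq.continuous (by simpa using hqint.norm)
  simp only [integral_mul_eq_integral_fderiv hq hdq (hψ _) (hψc _)] at h1
  simpa using tendsto_nhds_unique h1 h2

theorem ContDiffOn.contDiff_slice {n : ℕ} {V : Type*} [NormedAddCommGroup V] [NormedSpace ℝ V]
    {T : ℝ} {f : ℝ → EuclideanSpace ℝ (Fin n) → V}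
    (hf : ContDiffOn ℝ 1 (fun p : ℝ × EuclideanSpace ℝ (Fin n) => f p.1 p.2)
      (Set.Icc 0 T ×ˢ Set.univ)) {t : ℝ} (ht : t ∈ Set.Icc 0 T) : ContDiff ℝ 1 (f t) := by
  rw [← contDiffOn_univ]
  exact hf.comp (g := fun p : ℝ × EuclideanSpace ℝ (Fin n) => f p.1 p.2)
    (f := fun x => (t, x)) (by fun_prop) fun x _ => ⟨ht, Set.mem_univ x⟩

/-- Differentiation under the integral sign against a compactly supported weight. -/
theorem hasDerivAt_integral_mul_of_hasCompactSupport {n : ℕ} {T : ℝ}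
    {f : ℝ → EuclideanSpace ℝ (Fin n) → ℝ}
    (hf : ContDiffOn ℝ 1 (fun p : ℝ × EuclideanSpace ℝ (Fin n) => f p.1 p.2)
      (Set.Icc 0 T ×ˢ Set.univ)) {ψ : EuclideanSpace ℝ (Fin n) → ℝ} (hψ : Continuous ψ)
    (hψc : HasCompactSupport ψ) {t : ℝ} (ht : t ∈ Set.Ioo 0 T) :
    HasDerivAt (fun τ => ∫ x, ψ x * f τ x) (∫ x, ψ x * deriv (fun τ => f τ x) t) t := by
  set F : ℝ × EuclideanSpace ℝ (Fin n) → ℝ := fun p => f p.1 p.2 with hF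
  have hopen : IsOpen (Set.Ioo 0 T ×ˢ (Set.univ : Set (EuclideanSpace ℝ (Fin n)))) :=
    isOpen_Ioo.prod isOpen_univ
  have hf' : ContDiffOn ℝ 1 F (Set.Ioo 0 T ×ˢ Set.univ) :=
    hf.mono (Set.prod_mono Set.Ioo_subset_Icc_self subset_rfl)
  have hfd : ContinuousOn (fun p => fderiv ℝ F p (1, 0)) (Set.Ioo 0 T ×ˢ Set.univ) :=
    (hf'.continuousOn_fderiv_of_isOpen hopen (by norm_num)).clm_apply continuousOn_const
  have hder : ∀ τ ∈ Set.Ioo 0 T, ∀ x, HasDerivAt (fun τ => f τ x) (fderiv ℝ F (τ, x) (1, 0)) τ := by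
    intro τ hτ x
    have h1 : DifferentiableAt ℝ F (τ, x) :=
      (hf'.differentiableOn (by norm_num)).differentiableAt
        (hopen.mem_nhds ⟨hτ, Set.mem_univ x⟩)
    exact h1.hasFDerivAt.comp_hasDerivAt τ ((hasDerivAt_id τ).prodMk (hasDerivAt_const τ x))
  obtain ⟨ε, hε, hball⟩ := Metric.nhds_basis_closedBall.mem_iff.1 (isOpen_Ioo.mem_nhds ht)
  have hcompact : IsCompact (Metric.closedBall t ε ×ˢ tsupport ψ) :=
    (isCompact_closedBall t ε).prod hψc
  obtain ⟨B, hB⟩ := hcompact.exists_bound_of_continuousOn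
    (hfd.mono (Set.prod_mono hball (Set.subset_univ _)))
  have hsl : ∀ τ ∈ Set.Ioo 0 T, Continuous fun x => ψ x * f τ x := fun τ hτ =>
    hψ.mul (hf.contDiff_slice (Set.Ioo_subset_Icc_self hτ)).continuous
  have hdc : Continuous fun x => fderiv ℝ F (t, x) (1, 0) :=
    continuousOn_univ.1 (hfd.comp (f := fun x => (t, x)) (by fun_prop)
      fun x _ => ⟨ht, Set.mem_univ x⟩)
  have := (hasDerivAt_integral_of_dominated_loc_of_deriv_le (μ := volume)
    (F := fun τ x => ψ x * f τ x) (F' := fun τ x => ψ x * fderiv ℝ F (τ, x) (1, 0))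
    (bound := fun x => |ψ x| * B) (Metric.closedBall_mem_nhds t hε)
    (by filter_upwards [isOpen_Ioo.mem_nhds ht] with τ hτ
        exact (hsl τ hτ).aestronglyMeasurable)
    ((hsl t ht).integrable_of_hasCompactSupport hψc.mul_right)
    (hψ.mul hdc).aestronglyMeasurable
    (Eventually.of_forall fun x τ hτ => by
      by_cases hx : x ∈ tsupport ψ
      · rw [norm_mul]
        exact mul_le_mul_of_nonneg_left (hB (τ, x) ⟨hτ, hx⟩) (abs_nonneg _)
      · simp [image_eq_zero_of_notMem_tsupport hx])
    ((hψ.integrable_of_hasCompactSupport hψc).abs.mul_const B)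
    (Eventually.of_forall fun x τ hτ => (hder τ (hball hτ) x).const_mul _)).2
  simpa only [(hder t ht _).deriv] using this

/-- Moment balance for a conservation law `∂ₜf + div q = 0` with a flux bounded in `L¹(g dx)`. -/
theorem moment_sub_eq_integral_flux {n : ℕ} {T K : ℝ}
    {f : ℝ → EuclideanSpace ℝ (Fin n) → ℝ}
    {q : ℝ → EuclideanSpace ℝ (Fin n) → EuclideanSpace ℝ (Fin n)}
    (hf : ContDiffOn ℝ 1 (fun p : ℝ × EuclideanSpace ℝ (Fin n) => f p.1 p.2)
      (Set.Icc 0 T ×ˢ Set.univ))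
    (hq : ∀ t ∈ Set.Icc 0 T, ContDiff ℝ 1 (q t))
    (hfq : ∀ t ∈ Set.Icc 0 T, ∀ x, deriv (fun τ => f τ x) t
      + ∑ i : Fin n, fderiv ℝ (fun y => q t y i) x (EuclideanSpace.single i 1) = 0)
    {φ g : EuclideanSpace ℝ (Fin n) → ℝ} (hφ : ContDiff ℝ 1 φ)
    (hg : ∀ x, ‖fderiv ℝ φ x‖ ≤ g x) (hφg : ∀ x, |φ x| ≤ g x * (1 + ‖x‖))
    (hφf : ∀ t ∈ Set.Icc 0 T, Integrable fun x => φ x * f t x)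
    (hqg : ∀ t ∈ Set.Icc 0 T, Integrable fun x => ‖q t x‖ * g x)
    (hK : ∀ t ∈ Set.Icc 0 T, ∫ x, ‖q t x‖ * g x ≤ K)
    {a b : ℝ} (ha : a ∈ Set.Ioo 0 T) (hb : b ∈ Set.Ioo 0 T) :
    IntervalIntegrable (fun t => ∫ x, fderiv ℝ φ x (q t x)) volume a b ∧
      ∫ t in a..b, ∫ x, fderiv ℝ φ x (q t x) = (∫ x, φ x * f b x) - ∫ x, φ x * f a x := by
  obtain ⟨C, ψ, hψ, hψc, hψφ, hψg, hlim⟩ := exists_truncation hφ hg hφg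
  have hsub : Set.uIcc a b ⊆ Set.Ioo 0 T := Set.ordConnected_Ioo.uIcc_subset ha hb
  have hmem : ∀ t ∈ Set.Ioo 0 T, t ∈ Set.Icc 0 T := fun t ht => Set.Ioo_subset_Icc_self ht
  have hder : ∀ k, ∀ t ∈ Set.Ioo 0 T, HasDerivAt (fun τ => ∫ x, ψ k x * f τ x)
      (∫ x, fderiv ℝ (ψ k) x (q t x)) t := by
    intro k t ht
    rw [← integral_mul_eq_integral_fderiv (hq t (hmem t ht)) (hfq t (hmem t ht)) (hψ k) (hψc k)]
    exact hasDerivAt_integral_mul_of_hasCompactSupport hf (hψ k).continuous (hψc k) ht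
  have hbound : ∀ k, ∀ t ∈ Set.Ioo 0 T, ‖∫ x, fderiv ℝ (ψ k) x (q t x)‖ ≤ |C| * K := by
    intro k t ht
    have hg0 : ∀ x, 0 ≤ g x := fun x => (norm_nonneg _).trans (hg x)
    calc ‖∫ x, fderiv ℝ (ψ k) x (q t x)‖
        ≤ ∫ x, C * (‖q t x‖ * g x) := norm_integral_le_of_norm_le
          ((hqg t (hmem t ht)).const_mul C)
          (Eventually.of_forall fun x => norm_apply_le_of_truncation (hψg k) (q t) x)
      _ = C * ∫ x, ‖q t x‖ * g x := integral_const_mul _ _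
      _ ≤ |C| * ∫ x, ‖q t x‖ * g x := mul_le_mul_of_nonneg_right (le_abs_self C)
          (integral_nonneg fun x => mul_nonneg (norm_nonneg _) (hg0 x))
      _ ≤ |C| * K := mul_le_mul_of_nonneg_left (hK t (hmem t ht)) (abs_nonneg C)
  have hioc : ∀ t ∈ Set.uIoc a b, t ∈ Set.Ioo 0 T := fun t ht =>
    hsub (Set.uIoc_subset_uIcc ht)
  have hmeas : ∀ k, AEStronglyMeasurable (fun t => ∫ x, fderiv ℝ (ψ k) x (q t x))
      (volume.restrict (Set.uIoc a b)) := by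
    intro k
    refine (aestronglyMeasurable_deriv (fun τ => ∫ x, ψ k x * f τ x) _).congr ?_
    exact (ae_restrict_iff' measurableSet_uIoc).2
      (Eventually.of_forall fun t ht => (hder k t (hioc t ht)).deriv)
  have hconv : ∀ t ∈ Set.Ioo 0 T, Tendsto (fun k => ∫ x, fderiv ℝ (ψ k) x (q t x)) atTop
      (nhds (∫ x, fderiv ℝ φ x (q t x))) := fun t ht =>
    tendsto_integral_fderiv_of_truncation hψ hψg (fun x => (hlim x).mono fun k hk => hk.2)
      (hq t (hmem t ht)).continuous (hqg t (hmem t ht))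
  have hconst : IntegrableOn (fun _ : ℝ => |C| * K) (Set.uIoc a b) :=
    (intervalIntegrable_iff.1 intervalIntegrable_const)
  refine ⟨?_, ?_⟩
  · refine intervalIntegrable_iff.2 (hconst.mono' (aestronglyMeasurable_of_tendsto_ae atTop hmeas
      ((ae_restrict_iff' measurableSet_uIoc).2
        (Eventually.of_forall fun t ht => hconv t (hioc t ht))))
      ((ae_restrict_iff' measurableSet_uIoc).2 (Eventually.of_forall fun t ht => ?_)))
    exact le_of_tendsto (hconv t (hioc t ht)).norm
      (Eventually.of_forall fun k => hbound k t (hioc t ht))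
  · have h1 := intervalIntegral.tendsto_integral_filter_of_dominated_convergence
      (μ := volume) (a := a) (b := b) (fun _ => |C| * K) (Eventually.of_forall hmeas)
      (Eventually.of_forall fun k => Eventually.of_forall fun t ht => hbound k t (hioc t ht))
      intervalIntegrable_const (Eventually.of_forall fun t ht => hconv t (hioc t ht))
    have h2 : ∀ t ∈ Set.Ioo 0 T, Tendsto (fun k => ∫ x, ψ k x * f t x) atTop
        (nhds (∫ x, φ x * f t x)) := fun t ht =>
      tendsto_integral_mul_of_truncation (fun k => (hψ k).continuous) hψφ
        (fun x => (hlim x).mono fun k hk => hk.1)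
        (hf.contDiff_slice (hmem t ht)).continuous.aestronglyMeasurable (hφf t (hmem t ht))
    refine tendsto_nhds_unique h1 (((h2 b hb).sub (h2 a ha)).congr fun k => ?_)
    refine (intervalIntegral.integral_eq_sub_of_hasDerivAt (fun t ht => hder k t (hsub ht))
      (intervalIntegrable_iff.2 (hconst.mono' (hmeas k)
      ((ae_restrict_iff' measurableSet_uIoc).2
        (Eventually.of_forall fun t ht => hbound k t (hioc t ht)))))).symm

/-- A derivative is bounded by a continuous rate that dominates the increments. -/
theorem HasDerivAt.le_of_sub_le_integral {T t F' : ℝ} {F k : ℝ → ℝ} (hF : HasDerivAt F F' t)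
    (ht : t ∈ Set.Ioo 0 T) (hk : ContinuousOn k (Set.Icc 0 T))
    (h : ∀ a ∈ Set.Ioo 0 T, ∀ b ∈ Set.Ioo 0 T, a ≤ b → F b - F a ≤ ∫ τ in a..b, k τ) :
    F' ≤ k t := by
  have hkc : ContinuousOn k (Set.Ioo 0 T) := hk.mono Set.Ioo_subset_Icc_self
  have hki : ∀ a ∈ Set.Ioo 0 T, ∀ b ∈ Set.Ioo 0 T, IntervalIntegrable k volume a b :=
    fun a ha b hb => (hkc.mono (Set.ordConnected_Ioo.uIcc_subset ha hb)).intervalIntegrable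
  have hnhds : Set.Ioo 0 T ∈ nhds t := isOpen_Ioo.mem_nhds ht
  have hD : HasDerivAt (fun b => F b - ∫ τ in t..b, k τ) (F' - k t) t :=
    hF.sub (intervalIntegral.integral_hasDerivAt_right (by simp)
      (hkc.stronglyMeasurableAtFilter isOpen_Ioo t ht) (hkc.continuousAt hnhds))
  have hanti : AntitoneOn (fun b => F b - ∫ τ in t..b, k τ) (Set.Ioo 0 T) := by
    intro a ha b hb hab
    have h1 := h a ha b hb hab
    have h2 := intervalIntegral.integral_add_adjacent_intervals (hki t ht a ha) (hki a ha b hb)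
    simp only
    linarith
  have h3 := hanti.derivWithin_nonpos (x := t)
  rw [derivWithin_of_mem_nhds hnhds, hD.deriv] at h3
  linarith

theorem image_le_image_zero_of_hasDerivAt_nonpos {T : ℝ} {f : ℝ → ℝ}
    (hf : ContinuousOn f (Set.Icc 0 T))
    (hf' : ∀ t ∈ Set.Ioo 0 T, ∃ f', HasDerivAt f f' t ∧ f' ≤ 0) {t : ℝ} (ht : t ∈ Set.Icc 0 T) :
    f t ≤ f 0 := by
  refine antitoneOn_of_deriv_nonpos (convex_Icc 0 T) hf ?_ ?_
    ⟨le_rfl, ht.1.trans ht.2⟩ ht ht.1 <;> rw [interior_Icc] <;> intro τ hτ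
  · obtain ⟨f', h, -⟩ := hf' τ hτ
    exact h.differentiableAt.differentiableWithinAt
  · obtain ⟨f', h, h0⟩ := hf' τ hτ
    rwa [h.deriv]

namespace FullEulerSolution

variable {n : ℕ} {γ cν s₁ T : ℝ}

/-- The pressure `p = exp(s/c_ν) ρ^γ`. -/
def p (S : FullEulerSolution n γ cν s₁ T) (t : ℝ) (x : EuclideanSpace ℝ (Fin n)) : ℝ :=
  Real.exp (S.s t x / cν) * S.ρ t x ^ γ

variable (S : FullEulerSolution n γ cν s₁ T)

theorem p_nonneg {t : ℝ} (ht : t ∈ Set.Icc 0 T) (x : EuclideanSpace ℝ (Fin n)) :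
    0 ≤ S.p t x :=
  mul_nonneg (Real.exp_pos _).le (Real.rpow_nonneg (S.ρ_nonneg t ht x) γ)

theorem integrable_p {t : ℝ} (ht : t ∈ Set.Icc 0 T) : Integrable (S.p t) := S.int_p t ht

theorem contDiff_ρ {t : ℝ} (ht : t ∈ Set.Icc 0 T) : ContDiff ℝ 1 (S.ρ t) :=
  S.smooth_ρ.contDiff_slice ht

theorem contDiff_u {t : ℝ} (ht : t ∈ Set.Icc 0 T) : ContDiff ℝ 1 (S.u t) :=
  S.smooth_u.contDiff_slice ht

theorem contDiff_p (hγ : 1 < γ) {t : ℝ} (ht : t ∈ Set.Icc 0 T) : ContDiff ℝ 1 (S.p t) :=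
  ((S.smooth_s.contDiff_slice ht).div_const cν).exp.mul
    ((S.contDiff_ρ ht).rpow_const_of_le (m := 1) (by exact_mod_cast hγ.le))

theorem norm_ρ_smul_u {t : ℝ} (ht : t ∈ Set.Icc 0 T) (x : EuclideanSpace ℝ (Fin n)) :
    ‖S.ρ t x • S.u t x‖ = S.ρ t x * ‖S.u t x‖ := by
  rw [norm_smul, Real.norm_of_nonneg (S.ρ_nonneg t ht x)]

theorem hasDerivAt_M {t : ℝ} (ht : t ∈ Set.Icc 0 T) : HasDerivAt S.M 0 t := by
  have hq : ContDiff ℝ 1 fun x => S.ρ t x • S.u t x := (S.contDiff_ρ ht).smul (S.contDiff_u ht)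
  have h := integral_eq_zero_of_add_divergence_eq_zero hq (S.mass_eq t ht) <| by
    rw [← integrable_norm_iff hq.continuous.aestronglyMeasurable]
    simpa only [S.norm_ρ_smul_u ht] using S.int_ρu t ht
  have h' := S.hM t ht
  rw [h] at h'
  exact h'

theorem M_eq {t : ℝ} (ht : t ∈ Set.Icc 0 T) : S.M t = S.M 0 :=
  constant_of_has_deriv_right_zero
    (fun _ hτ => (S.hasDerivAt_M hτ).continuousAt.continuousWithinAt)
    (fun _ hτ => (S.hasDerivAt_M (Set.Ico_subset_Icc_self hτ)).hasDerivWithinAt) t ht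

theorem exists_bound_u {t : ℝ} (ht : t ∈ Set.Icc 0 T) : ∃ C, ∀ x, ‖S.u t x‖ ≤ C := by
  have h := (S.decay_u t ht).eventually (ge_mem_nhds one_pos)
  rw [Metric.cobounded_eq_cocompact] at h
  obtain ⟨K, hK, hsub⟩ := mem_cocompact.1 h
  obtain ⟨B, hB⟩ := hK.exists_bound_of_continuousOn (S.contDiff_u ht).continuous.continuousOn
  refine ⟨max B 1, fun x => ?_⟩
  by_cases hx : x ∈ K
  · exact (hB x hx).trans (le_max_left _ _)
  · exact (hsub hx).trans (le_max_right _ _)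

theorem integral_energy_density {t : ℝ} (ht : t ∈ Set.Icc 0 T) :
    ∫ x, ((1 / 2 : ℝ) * S.ρ t x * ‖S.u t x‖ ^ 2
        + Real.exp (S.s t x / cν) * S.ρ t x ^ γ / (γ - 1)) = S.E t := by
  have h1 := S.int_ρu2 t ht
  have h2 := S.int_p t ht
  simp only [mul_assoc (1 / 2 : ℝ)]
  rw [integral_add (h1.const_mul _) (h2.div_const _), integral_const_mul, integral_div, E, Ek, Ei]
  ring

theorem E_eq (hγ : 1 < γ) {t : ℝ} (ht : t ∈ Set.Icc 0 T) : S.E t = S.E 0 := by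
  have hder : ∀ τ ∈ Set.Icc 0 T, HasDerivAt (fun τ => ∫ x, ((1 / 2 : ℝ) * S.ρ τ x * ‖S.u τ x‖ ^ 2
        + Real.exp (S.s τ x / cν) * S.ρ τ x ^ γ / (γ - 1))) 0 τ := by
    intro τ hτ
    have hρ := S.contDiff_ρ hτ
    have hu := S.contDiff_u hτ
    have hp := S.contDiff_p hγ hτ
    have hw : ContDiff ℝ 1 fun x =>
        (1 / 2 : ℝ) * S.ρ τ x * ‖S.u τ x‖ ^ 2 + γ * S.p τ x / (γ - 1) :=
      ((contDiff_const.mul hρ).mul (hu.norm_sq ℝ)).add ((contDiff_const.mul hp).div_const _)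
    have hwint : Integrable fun x =>
        (1 / 2 : ℝ) * S.ρ τ x * ‖S.u τ x‖ ^ 2 + γ * S.p τ x / (γ - 1) := by
      simp only [mul_assoc (1 / 2 : ℝ)]
      exact ((S.int_ρu2 τ hτ).const_mul _).add (((S.integrable_p hτ).const_mul _).div_const _)
    obtain ⟨C, hC⟩ := S.exists_bound_u hτ
    have h := integral_eq_zero_of_add_divergence_eq_zero (hw.smul hu) (S.energy_eq τ hτ)
      (hwint.smul_bdd C hu.continuous.aestronglyMeasurable (Eventually.of_forall hC))
    simpa only [h] using S.hE τ hτ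
  rw [← S.integral_energy_density ht, ← S.integral_energy_density ⟨le_rfl, ht.1.trans ht.2⟩]
  exact constant_of_has_deriv_right_zero
    (fun τ hτ => (hder τ hτ).continuousAt.continuousWithinAt)
    (fun τ hτ => (hder τ (Set.Ico_subset_Icc_self hτ)).hasDerivWithinAt) t ht

theorem Ek_nonneg {t : ℝ} (ht : t ∈ Set.Icc 0 T) : 0 ≤ S.Ek t :=
  mul_nonneg (by norm_num)
    (integral_nonneg fun x => mul_nonneg (S.ρ_nonneg t ht x) (sq_nonneg _))

theorem Ei_nonneg (hγ : 1 < γ) {t : ℝ} (ht : t ∈ Set.Icc 0 T) : 0 ≤ S.Ei t :=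
  mul_nonneg (one_div_nonneg.2 (by linarith)) (integral_nonneg (S.p_nonneg ht))

theorem continuousOn_G : ContinuousOn S.G (Set.Icc 0 T) := fun t ht =>
  (S.hG t ht).continuousAt.continuousWithinAt

theorem continuousOn_F : ContinuousOn S.F (Set.Icc 0 T) := fun t ht =>
  (S.hF t ht).continuousAt.continuousWithinAt

theorem integral_F_eq_sub (hγ : 1 < γ) {a b : ℝ} (ha : a ∈ Set.Ioo 0 T) (hb : b ∈ Set.Ioo 0 T) :
    ∫ t in a..b, S.F t = S.G b - S.G a := by
  obtain ⟨B, hB⟩ := isCompact_Icc.exists_bound_of_continuousOn S.continuousOn_G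
  have hφ : ∀ x : EuclideanSpace ℝ (Fin n),
      HasFDerivAt (fun y : EuclideanSpace ℝ (Fin n) => (1 / 2 : ℝ) * ‖y‖ ^ 2) (innerSL ℝ x) x := by
    intro x
    convert! (hasStrictFDerivAt_norm_sq x).hasFDerivAt.const_mul (1 / 2 : ℝ) using 1
    ext v; simp
  have hnorm : ∀ t ∈ Set.Icc 0 T, (fun x => ‖S.ρ t x • S.u t x‖ * ‖x‖)
      = fun x => S.ρ t x * ‖S.u t x‖ * ‖x‖ := fun t ht => by
    funext x; rw [S.norm_ρ_smul_u ht]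
  have h := (moment_sub_eq_integral_flux (K := S.E 0 + B) (f := S.ρ)
    (q := fun t x => S.ρ t x • S.u t x) (φ := fun x => (1 / 2 : ℝ) * ‖x‖ ^ 2)
    (g := fun x => ‖x‖) S.smooth_ρ (fun t ht => (S.contDiff_ρ ht).smul (S.contDiff_u ht))
    S.mass_eq (contDiff_const.mul (contDiff_norm_sq ℝ)) ?_ ?_ ?_ ?_ ?_ ha hb).2
  · simp only [(hφ _).fderiv, innerSL_apply_apply, inner_smul_right] at h
    simp only [F, G]
    simp only [mul_assoc, integral_const_mul, mul_comm (‖_‖ ^ 2)] at h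
    simpa only [real_inner_comm] using h
  · intro x
    rw [(hφ x).fderiv, innerSL_apply_norm]
  · intro x
    rw [abs_of_nonneg (by positivity)]
    nlinarith [norm_nonneg x]
  · intro t ht
    convert! (S.int_ρx2 t ht).const_mul (1 / 2) using 2
    ring
  · intro t ht
    rw [hnorm t ht]
    exact S.int_ρux t ht
  · intro t ht
    rw [hnorm t ht]
    calc ∫ x, S.ρ t x * ‖S.u t x‖ * ‖x‖
        ≤ ∫ x, ((1 / 2 : ℝ) * (S.ρ t x * ‖S.u t x‖ ^ 2) + 1 / 2 * (S.ρ t x * ‖x‖ ^ 2)) := by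
          refine integral_mono (S.int_ρux t ht) (((S.int_ρu2 t ht).const_mul _).add
            ((S.int_ρx2 t ht).const_mul _)) fun x => ?_
          nlinarith [mul_nonneg (S.ρ_nonneg t ht x) (sq_nonneg (‖S.u t x‖ - ‖x‖))]
      _ = S.Ek t + S.G t := by
          rw [integral_add ((S.int_ρu2 t ht).const_mul _) ((S.int_ρx2 t ht).const_mul _),
            integral_const_mul, integral_const_mul, Ek, G]
      _ ≤ S.E 0 + B := by
          have h1 := S.Ei_nonneg hγ ht
          have h2 : S.Ek t + S.Ei t = S.E 0 := S.E_eq hγ ht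
          have h3 := (le_abs_self _).trans (hB t ht)
          linarith

/-- The flux `ρ uᵢ u + p eᵢ` of the `i`-th momentum component. -/
def momentumFlux (i : Fin n) (t : ℝ) (x : EuclideanSpace ℝ (Fin n)) : EuclideanSpace ℝ (Fin n) :=
  (S.ρ t x * S.u t x i) • S.u t x + S.p t x • EuclideanSpace.single i 1

theorem contDiff_momentumFlux (hγ : 1 < γ) (i : Fin n) {t : ℝ} (ht : t ∈ Set.Icc 0 T) :
    ContDiff ℝ 1 (S.momentumFlux i t) := by
  have hρ := S.contDiff_ρ ht
  have hu := S.contDiff_u ht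
  have hp := S.contDiff_p hγ ht
  unfold momentumFlux
  fun_prop

theorem norm_momentumFlux_le (i : Fin n) {t : ℝ} (ht : t ∈ Set.Icc 0 T)
    (x : EuclideanSpace ℝ (Fin n)) :
    ‖S.momentumFlux i t x‖ ≤ S.ρ t x * ‖S.u t x‖ ^ 2 + S.p t x := by
  have hρ := S.ρ_nonneg t ht x
  refine (norm_add_le _ _).trans ?_
  rw [norm_smul, norm_smul, norm_mul, Real.norm_of_nonneg hρ,
    Real.norm_of_nonneg (S.p_nonneg ht x), PiLp.norm_single, norm_one, mul_one, sq,
    ← mul_assoc]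
  gcongr
  exact PiLp.norm_apply_le _ i

theorem deriv_add_divergence_momentumFlux (hγ : 1 < γ) (i : Fin n) {t : ℝ}
    (ht : t ∈ Set.Icc 0 T) (x : EuclideanSpace ℝ (Fin n)) :
    deriv (fun τ => S.ρ τ x * S.u τ x i) t + ∑ j : Fin n,
      fderiv ℝ (fun y => S.momentumFlux i t y j) x (EuclideanSpace.single j 1) = 0 := by
  have hρ := S.contDiff_ρ ht
  have hu := S.contDiff_u ht
  have hp := (S.contDiff_p hγ ht).differentiable (by norm_num) x
  have hterm : ∀ j : Fin n,
      fderiv ℝ (fun y => S.momentumFlux i t y j) x (EuclideanSpace.single j 1)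
        = fderiv ℝ (fun y => S.ρ t y * S.u t y i * S.u t y j) x (EuclideanSpace.single j 1)
          + if j = i then fderiv ℝ (S.p t) x (EuclideanSpace.single j 1) else 0 := by
    intro j
    have hd : DifferentiableAt ℝ (fun y => S.ρ t y * S.u t y i * S.u t y j) x :=
      ContDiff.differentiable (n := 1) (by fun_prop) (by norm_num) x
    by_cases hj : j = i
    · have : (fun y => S.momentumFlux i t y j)
          = fun y => S.ρ t y * S.u t y i * S.u t y j + S.p t y := by
        funext y; simp [momentumFlux, hj]
      rw [this, fderiv_fun_add hd hp, if_pos hj]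
      rfl
    · have : (fun y => S.momentumFlux i t y j)
          = fun y => S.ρ t y * S.u t y i * S.u t y j := by
        funext y; simp [momentumFlux, hj]
      rw [this, if_neg hj, add_zero]
  simp only [hterm, Finset.sum_add_distrib, Finset.sum_ite_eq', Finset.mem_univ, if_true]
  rw [← add_assoc]
  exact S.momentum_eq t ht x i

theorem integrable_ρu2_add_p {t : ℝ} (ht : t ∈ Set.Icc 0 T) :
    Integrable fun x => S.ρ t x * ‖S.u t x‖ ^ 2 + S.p t x :=
  (S.int_ρu2 t ht).add (S.integrable_p ht)

theorem integrable_momentumFlux (hγ : 1 < γ) (i : Fin n) {t : ℝ} (ht : t ∈ Set.Icc 0 T) :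
    Integrable (S.momentumFlux i t) :=
  (S.integrable_ρu2_add_p ht).mono'
    (S.contDiff_momentumFlux hγ i ht).continuous.aestronglyMeasurable
    (Eventually.of_forall (S.norm_momentumFlux_le i ht))

theorem integral_norm_momentumFlux_le (hγ : 1 < γ) (i : Fin n) {t : ℝ} (ht : t ∈ Set.Icc 0 T) :
    ∫ x, ‖S.momentumFlux i t x‖ ≤ 2 * S.E 0 + (γ - 1) * S.E 0 := by
  have hγ1 : γ - 1 ≠ 0 := by linarith
  calc ∫ x, ‖S.momentumFlux i t x‖ ≤ ∫ x, (S.ρ t x * ‖S.u t x‖ ^ 2 + S.p t x) :=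
        integral_mono (S.integrable_momentumFlux hγ i ht).norm (S.integrable_ρu2_add_p ht)
          (S.norm_momentumFlux_le i ht)
    _ = 2 * S.Ek t + (γ - 1) * S.Ei t := by
        rw [integral_add (S.int_ρu2 t ht) (S.integrable_p ht), Ek, Ei]
        simp only [p]
        field_simp
    _ ≤ 2 * S.E 0 + (γ - 1) * S.E 0 := by
        have h1 := S.Ei_nonneg hγ ht
        have h2 := S.Ek_nonneg ht
        have h3 : S.Ek t + S.Ei t = S.E 0 := S.E_eq hγ ht
        have h4 := mul_nonneg (sub_pos.2 hγ).le h2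
        rw [← h3]
        linarith

theorem integrable_coord_mul_momentum (i : Fin n) {t : ℝ} (ht : t ∈ Set.Icc 0 T) :
    Integrable fun x : EuclideanSpace ℝ (Fin n) => x i * (S.ρ t x * S.u t x i) := by
  have hρ := (S.contDiff_ρ ht).continuous
  have hu := (S.contDiff_u ht).continuous
  refine (S.int_ρux t ht).mono' (Continuous.aestronglyMeasurable (by fun_prop))
    (Eventually.of_forall fun x => ?_)
  rw [norm_mul, norm_mul, Real.norm_of_nonneg (S.ρ_nonneg t ht x), mul_comm]
  gcongr
  exacts [mul_nonneg (S.ρ_nonneg t ht x) (norm_nonneg _), S.ρ_nonneg t ht x,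
    PiLp.norm_apply_le _ i, PiLp.norm_apply_le _ i]

theorem F_eq_sum {t : ℝ} (ht : t ∈ Set.Icc 0 T) :
    S.F t = ∑ i, ∫ x : EuclideanSpace ℝ (Fin n), x i * (S.ρ t x * S.u t x i) := by
  rw [← integral_finsetSum _ fun i _ => S.integrable_coord_mul_momentum i ht, F]
  congr 1 with x
  rw [PiLp.inner_apply, Finset.mul_sum]
  refine Finset.sum_congr rfl fun i _ => ?_
  simp only [RCLike.inner_apply, conj_trivial]
  ring

theorem sum_integral_momentumFlux (hγ : 1 < γ) {t : ℝ} (ht : t ∈ Set.Icc 0 T) :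
    ∑ i : Fin n, ∫ x, S.momentumFlux i t x i = 2 * S.Ek t + n * (γ - 1) * S.Ei t := by
  have hγ1 : γ - 1 ≠ 0 := by linarith
  have hint : ∀ i : Fin n, Integrable fun x => S.momentumFlux i t x i := fun i =>
    (EuclideanSpace.proj (𝕜 := ℝ) i).integrable_comp (S.integrable_momentumFlux hγ i ht)
  have hx : ∀ x, ∑ i : Fin n, S.momentumFlux i t x i
      = S.ρ t x * ‖S.u t x‖ ^ 2 + n * S.p t x := by
    intro x
    rw [EuclideanSpace.real_norm_sq_eq, Finset.mul_sum]
    simp [momentumFlux, Finset.sum_add_distrib, sq, mul_assoc]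
  rw [← integral_finsetSum _ fun i _ => hint i]
  simp only [hx]
  rw [integral_add (S.int_ρu2 t ht) ((S.integrable_p ht).const_mul _), integral_const_mul, Ek, Ei]
  simp only [p]
  field_simp

theorem integral_momentumFlux_eq_sub (hγ : 1 < γ) (i : Fin n) {a b : ℝ} (ha : a ∈ Set.Ioo 0 T)
    (hb : b ∈ Set.Ioo 0 T) :
    IntervalIntegrable (fun t => ∫ x, S.momentumFlux i t x i) volume a b ∧
      ∫ t in a..b, ∫ x, S.momentumFlux i t x i
        = (∫ x : EuclideanSpace ℝ (Fin n), x i * (S.ρ b x * S.u b x i))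
          - ∫ x : EuclideanSpace ℝ (Fin n), x i * (S.ρ a x * S.u a x i) := by
  have hfd : ∀ x : EuclideanSpace ℝ (Fin n),
      fderiv ℝ (fun y : EuclideanSpace ℝ (Fin n) => y i) x = EuclideanSpace.proj i := fun x =>
    (EuclideanSpace.proj (𝕜 := ℝ) i).fderiv
  have hsmooth : ContDiffOn ℝ 1
      (fun p : ℝ × EuclideanSpace ℝ (Fin n) => S.ρ p.1 p.2 * S.u p.1 p.2 i)
      (Set.Icc 0 T ×ˢ Set.univ) :=
    S.smooth_ρ.mul ((EuclideanSpace.proj (𝕜 := ℝ) i).contDiff.comp_contDiffOn S.smooth_u)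
  have hflux : ∀ t x, fderiv ℝ (fun y : EuclideanSpace ℝ (Fin n) => y i) x
      (S.momentumFlux i t x) = S.momentumFlux i t x i := fun t x => by
    rw [hfd]; rfl
  have h := moment_sub_eq_integral_flux (K := 2 * S.E 0 + (γ - 1) * S.E 0)
    (f := fun t x => S.ρ t x * S.u t x i)
    (q := S.momentumFlux i) (φ := fun x => x i) (g := fun _ => 1) hsmooth
    (fun t ht => S.contDiff_momentumFlux hγ i ht)
    (fun t ht => S.deriv_add_divergence_momentumFlux hγ i ht) (by fun_prop)
    (fun x => by
      rw [hfd]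
      exact ContinuousLinearMap.opNorm_le_bound _ zero_le_one fun v => by
        rw [one_mul]; exact PiLp.norm_apply_le v i)
    (fun x => by
      have := PiLp.norm_apply_le x i
      rw [Real.norm_eq_abs] at this
      linarith)
    (fun t ht => S.integrable_coord_mul_momentum i ht)
    (fun t ht => by simpa using (S.integrable_momentumFlux hγ i ht).norm)
    (fun t ht => by simpa using S.integral_norm_momentumFlux_le hγ i ht) ha hb
  simpa only [hflux] using h

theorem integral_eq_F_sub (hγ : 1 < γ) {a b : ℝ} (ha : a ∈ Set.Ioo 0 T) (hb : b ∈ Set.Ioo 0 T) :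
    IntervalIntegrable (fun t => 2 * S.Ek t + n * (γ - 1) * S.Ei t) volume a b ∧
      ∫ t in a..b, (2 * S.Ek t + n * (γ - 1) * S.Ei t) = S.F b - S.F a := by
  have h := fun i : Fin n => S.integral_momentumFlux_eq_sub hγ i ha hb
  have hmem : ∀ t ∈ Set.uIcc a b, t ∈ Set.Icc 0 T := fun t ht =>
    Set.Ioo_subset_Icc_self (Set.ordConnected_Ioo.uIcc_subset ha hb ht)
  have hsum : ∀ t ∈ Set.uIcc a b,
      ∑ i : Fin n, ∫ x, S.momentumFlux i t x i = 2 * S.Ek t + n * (γ - 1) * S.Ei t :=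
    fun t ht => S.sum_integral_momentumFlux hγ (hmem t ht)
  refine ⟨(IntervalIntegrable.sum Finset.univ fun i _ => (h i).1).congr fun t ht => ?_, ?_⟩
  · simpa using hsum t (Set.uIoc_subset_uIcc ht)
  · rw [← intervalIntegral.integral_congr hsum,
      intervalIntegral.integral_finsetSum fun i _ => (h i).1,
      S.F_eq_sum (hmem a Set.left_mem_uIcc),
      S.F_eq_sum (hmem b Set.right_mem_uIcc), ← Finset.sum_sub_distrib]
    exact Finset.sum_congr rfl fun i _ => (h i).2

theorem J_eq (hγ : 1 < γ) {t : ℝ} (ht : t ∈ Set.Icc 0 T) :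
    S.J t = S.G t - (t + 1) * S.F t + (t + 1) ^ 2 * S.E 0 := by
  rw [J, S.E_eq hγ ht]

theorem sq_mul_Ei_le_J {t : ℝ} (ht : t ∈ Set.Icc 0 T) : (t + 1) ^ 2 * S.Ei t ≤ S.J t := by
  have hρ := (S.contDiff_ρ ht).continuous
  have hu := (S.contDiff_u ht).continuous
  have hF : Integrable fun x => S.ρ t x * ⟪S.u t x, x⟫_ℝ := by
    refine (S.int_ρux t ht).mono' (Continuous.aestronglyMeasurable (by fun_prop))
      (Eventually.of_forall fun x => ?_)
    rw [norm_mul, Real.norm_of_nonneg (S.ρ_nonneg t ht x), mul_assoc]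
    exact mul_le_mul_of_nonneg_left (norm_inner_le_norm _ _) (S.ρ_nonneg t ht x)
  have h : 0 ≤ ∫ x, S.ρ t x * ‖x - (t + 1) • S.u t x‖ ^ 2 :=
    integral_nonneg fun x => mul_nonneg (S.ρ_nonneg t ht x) (sq_nonneg _)
  have hx : ∀ x, S.ρ t x * ‖x - (t + 1) • S.u t x‖ ^ 2 = S.ρ t x * ‖x‖ ^ 2
      - 2 * (t + 1) * (S.ρ t x * ⟪S.u t x, x⟫_ℝ)
      + (t + 1) ^ 2 * (S.ρ t x * ‖S.u t x‖ ^ 2) := by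
    intro x
    rw [norm_sub_sq_real, inner_smul_right, norm_smul, mul_pow, Real.norm_eq_abs, sq_abs,
      real_inner_comm]
    ring
  have hsub : Integrable fun x =>
      S.ρ t x * ‖x‖ ^ 2 - 2 * (t + 1) * (S.ρ t x * ⟪S.u t x, x⟫_ℝ) :=
    (S.int_ρx2 t ht).sub (hF.const_mul _)
  simp only [hx] at h
  rw [integral_add hsub ((S.int_ρu2 t ht).const_mul _),
    integral_sub (S.int_ρx2 t ht) (hF.const_mul _), integral_const_mul, integral_const_mul] at h
  simp only [J, E, Ek, G, F]
  linarith

theorem hasDerivAt_G (hγ : 1 < γ) {t : ℝ} (ht : t ∈ Set.Ioo 0 T) : HasDerivAt S.G (S.F t) t := by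
  have hG : HasDerivAt S.G _ t := S.hG t (Set.Ioo_subset_Icc_self ht)
  have h1 := hG.le_of_sub_le_integral ht S.continuousOn_F
    fun a ha b hb _ => (S.integral_F_eq_sub hγ ha hb).ge
  have h2 := hG.neg.le_of_sub_le_integral ht S.continuousOn_F.neg fun a ha b hb _ => by
    simp only [Pi.neg_apply]
    rw [intervalIntegral.integral_neg, S.integral_F_eq_sub hγ ha hb]
    linarith
  rw [show S.F t = _ from le_antisymm (neg_le_neg_iff.1 h2) h1]
  exact hG

theorem continuousOn_J (hγ : 1 < γ) : ContinuousOn S.J (Set.Icc 0 T) := by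
  have hF := S.continuousOn_F
  have hG := S.continuousOn_G
  refine ContinuousOn.congr (f := fun t => S.G t - (t + 1) * S.F t + (t + 1) ^ 2 * S.E 0)
    (by fun_prop) fun t ht => S.J_eq hγ ht

theorem exists_hasDerivAt_F (hγ : 1 < γ) (hκ : n * (γ - 1) ≤ 2) {t : ℝ} (ht : t ∈ Set.Ioo 0 T) :
    ∃ F', HasDerivAt S.F F' t ∧ F' ≤ 2 * S.E 0 ∧
      2 * S.E 0 - (2 - n * (γ - 1)) * (S.J t / (t + 1) ^ 2) ≤ F' := by
  have hF : HasDerivAt S.F _ t := S.hF t (Set.Ioo_subset_Icc_self ht)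
  have hsub : ∀ a ∈ Set.Ioo 0 T, ∀ b ∈ Set.Ioo 0 T, Set.uIcc a b ⊆ Set.Icc 0 T :=
    fun a ha b hb => (Set.ordConnected_Ioo.uIcc_subset ha hb).trans Set.Ioo_subset_Icc_self
  have hrate : ContinuousOn
      (fun τ => -(2 * S.E 0 - (2 - n * (γ - 1)) * (S.J τ / (τ + 1) ^ 2))) (Set.Icc 0 T) := by
    have hJ := S.continuousOn_J hγ
    have hdiv : ContinuousOn (fun τ => S.J τ / (τ + 1) ^ 2) (Set.Icc 0 T) :=
      hJ.div (by fun_prop) fun τ hτ => by have := hτ.1; positivity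
    fun_prop
  refine ⟨_, hF, ?_, ?_⟩
  · refine hF.le_of_sub_le_integral (k := fun _ => 2 * S.E 0) ht continuousOn_const
      fun a ha b hb hab => ?_
    obtain ⟨hi, he⟩ := S.integral_eq_F_sub hγ ha hb
    rw [← he]
    refine intervalIntegral.integral_mono_on hab hi intervalIntegrable_const fun τ hτ => ?_
    have hτ' := hsub a ha b hb (Set.Icc_subset_uIcc hτ)
    have h1 := mul_le_mul_of_nonneg_right hκ (S.Ei_nonneg hγ hτ')
    have h2 : S.Ek τ + S.Ei τ = S.E 0 := S.E_eq hγ hτ'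
    linarith
  · refine neg_le_neg_iff.1 (hF.neg.le_of_sub_le_integral ht hrate fun a ha b hb hab => ?_)
    obtain ⟨hi, he⟩ := S.integral_eq_F_sub hγ ha hb
    simp only [Pi.neg_apply]
    rw [show -S.F b - -S.F a = -(S.F b - S.F a) by ring, ← he, ← intervalIntegral.integral_neg]
    refine intervalIntegral.integral_mono_on hab hi.neg
      (hrate.mono (hsub a ha b hb)).intervalIntegrable fun τ hτ => ?_
    have hτ' := hsub a ha b hb (Set.Icc_subset_uIcc hτ)
    have hτ1 : 0 < τ + 1 := by linarith [hτ'.1]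
    have h1 : S.Ei τ ≤ S.J τ / (τ + 1) ^ 2 := by
      rw [le_div_iff₀ (by positivity), mul_comm]
      exact S.sq_mul_Ei_le_J hτ'
    have h2 := mul_le_mul_of_nonneg_left h1 (sub_nonneg.2 hκ)
    have h3 : S.Ek τ + S.Ei τ = S.E 0 := S.E_eq hγ hτ'
    linarith

theorem G_le (hγ : 1 < γ) (hκ : n * (γ - 1) ≤ 2) {t : ℝ} (ht : t ∈ Set.Icc 0 T) :
    S.G t ≤ S.G 0 + S.F 0 * t + S.E 0 * t ^ 2 := by
  have hFc := S.continuousOn_F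
  have hGc := S.continuousOn_G
  have hF : ∀ τ ∈ Set.Icc 0 T, S.F τ ≤ S.F 0 + 2 * S.E 0 * τ := by
    intro τ hτ
    have := image_le_image_zero_of_hasDerivAt_nonpos (f := fun τ => S.F τ - 2 * S.E 0 * τ)
      (by fun_prop) (fun r hr => by
        obtain ⟨F', h1, h2, -⟩ := S.exists_hasDerivAt_F hγ hκ hr
        exact ⟨_, h1.sub ((hasDerivAt_id r).const_mul (2 * S.E 0)), by linarith⟩) hτ
    simp only [mul_zero, sub_zero] at this
    linarith
  have := image_le_image_zero_of_hasDerivAt_nonpos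
    (f := fun τ => S.G τ - (S.F 0 * τ + S.E 0 * τ ^ 2)) (by fun_prop) (fun r hr =>
      ⟨_, (S.hasDerivAt_G hγ hr).sub (((hasDerivAt_id r).const_mul (S.F 0)).add
        ((hasDerivAt_pow 2 r).const_mul (S.E 0))), by
        have := hF r (Set.Ioo_subset_Icc_self hr)
        norm_num
        linarith⟩) ht
  norm_num at this
  linarith

theorem J_mul_rpow_le (hγ : 1 < γ) (hκ : n * (γ - 1) ≤ 2) {t : ℝ} (ht : t ∈ Set.Icc 0 T) :
    S.J t * (t + 1) ^ ((n : ℝ) * (γ - 1) - 2) ≤ S.J 0 := by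
  have hJc := S.continuousOn_J hγ
  have := image_le_image_zero_of_hasDerivAt_nonpos
    (f := fun τ => S.J τ * (τ + 1) ^ ((n : ℝ) * (γ - 1) - 2))
    (hJc.mul (ContinuousOn.rpow_const (by fun_prop) fun τ hτ => Or.inl (by linarith [hτ.1])))
    (fun r hr => ?_) ht
  · simpa using this
  · obtain ⟨F', h1, -, h2⟩ := S.exists_hasDerivAt_F hγ hκ hr
    have hr1 : 0 < r + 1 := by linarith [hr.1]
    have hlin : HasDerivAt (fun τ : ℝ => τ + 1) 1 r := (hasDerivAt_id r).add_const 1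
    have hJ : HasDerivAt S.J ((r + 1) * (2 * S.E 0 - F')) r := by
      have h3 := ((S.hasDerivAt_G hγ hr).sub (hlin.mul h1)).add
        ((hlin.pow 2).mul_const (S.E 0))
      refine (h3.congr_of_eventuallyEq ?_).congr_deriv (by norm_num; ring)
      filter_upwards [isOpen_Ioo.mem_nhds hr] with τ hτ
      exact S.J_eq hγ (Set.Ioo_subset_Icc_self hτ)
    refine ⟨_, hJ.mul (hlin.rpow_const (p := (n : ℝ) * (γ - 1) - 2) (Or.inl hr1.ne')), ?_⟩
    have h4 : (r + 1) ^ ((n : ℝ) * (γ - 1) - 2)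
        = (r + 1) ^ ((n : ℝ) * (γ - 1) - 2 - 1) * (r + 1) := by
      rw [← Real.rpow_add_one hr1.ne']; ring_nf
    rw [h4]
    have h5 : (2 * S.E 0 - F') * (r + 1) ^ 2 ≤ (2 - n * (γ - 1)) * S.J r := by
      rw [← le_div_iff₀ (by positivity), mul_div_assoc]
      linarith
    have h6 := mul_le_mul_of_nonneg_left h5
      (Real.rpow_nonneg hr1.le ((n : ℝ) * (γ - 1) - 2 - 1))
    linarith

theorem exp_mul_integral_rpow_le_Ei (hγ : 1 < γ) (hcν : 0 < cν) {t : ℝ}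
    (ht : t ∈ Set.Icc 0 T) : Integrable (fun x => S.ρ t x ^ γ) ∧
      Real.exp (s₁ / cν) * (∫ x, S.ρ t x ^ γ) ≤ (γ - 1) * S.Ei t := by
  have hle : ∀ x, Real.exp (s₁ / cν) * S.ρ t x ^ γ ≤ S.p t x := fun x =>
    mul_le_mul_of_nonneg_right
      (Real.exp_le_exp.2 (div_le_div_of_nonneg_right (S.entropy_lb t ht x) hcν.le))
      (Real.rpow_nonneg (S.ρ_nonneg t ht x) γ)
  have hc : Continuous fun x => S.ρ t x ^ γ :=
    (S.contDiff_ρ ht).continuous.rpow_const fun x => Or.inr (by linarith)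
  have hint : Integrable fun x => Real.exp (s₁ / cν) * S.ρ t x ^ γ :=
    (S.integrable_p ht).mono' (hc.aestronglyMeasurable.const_mul _)
      (Eventually.of_forall fun x => by
        rw [Real.norm_of_nonneg
          (mul_nonneg (Real.exp_pos _).le (Real.rpow_nonneg (S.ρ_nonneg t ht x) γ))]
        exact hle x)
  refine ⟨(integrable_const_mul_iff (Real.exp_pos (s₁ / cν)).ne'.isUnit _).1 hint, ?_⟩
  have hγ1 : γ - 1 ≠ 0 := by linarith
  calc Real.exp (s₁ / cν) * (∫ x, S.ρ t x ^ γ)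
      = ∫ x, Real.exp (s₁ / cν) * S.ρ t x ^ γ := (integral_const_mul _ _).symm
    _ ≤ ∫ x, S.p t x := integral_mono hint (S.integrable_p ht) hle
    _ = (γ - 1) * S.Ei t := by
        rw [Ei]
        simp only [p]
        field_simp

end FullEulerSolution


/-- **Theorem 2.1 (Euler case): blow-up for the full compressible Euler equations.**
Let `1 < γ ≤ 1 + 2/n`. If the initial physical quantities satisfy `M(0) > 0`,
`ℙ(0) ≠ 0`, `E(0) > 0` and
`E(0)^{n(γ−1)/2} J(0) / (exp(s₁/c_ν) M(0)^{((n+2)γ−n)/2})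
  < (Γ(n/2+1)/π^{n/2})^{γ−1} / (2^{((n+2)γ−n)/2}(γ−1))`
with `J(0) = G(0) − F(0) + E(0)` and `s₁ = min_x s(x,0)`, then there is a finite time
`T₁* > 0` such that no classical solution (in the sense of `FullEulerSolution`, which
encodes the decay, integrability and entropy conditions) with these initial physical
quantities exists on `ℝⁿ × [0,T]` for any `T ≥ T₁*`; in particular there is no
global-in-time solution. -/
theorem full_euler_blowup
    (n : ℕ) (hn : 1 ≤ n) (γ : ℝ) (hγ : 1 < γ) (hγn : γ ≤ 1 + 2 / n)
    (cν : ℝ) (hcν : 0 < cν) (s₁ : ℝ)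
    (M₀ : ℝ) (hM₀ : 0 < M₀)
    (P₀ : EuclideanSpace ℝ (Fin n)) (hP₀ : P₀ ≠ 0)
    (F₀ G₀ : ℝ) (E₀ : ℝ) (hE₀ : 0 < E₀)
    (hcond : E₀ ^ ((n : ℝ) * (γ - 1) / 2) * (G₀ - F₀ + E₀)
        / (Real.exp (s₁ / cν) * M₀ ^ ((((n : ℝ) + 2) * γ - n) / 2))
      < (Real.Gamma ((n : ℝ) / 2 + 1) / Real.pi ^ ((n : ℝ) / 2)) ^ (γ - 1)
        / ((2 : ℝ) ^ ((((n : ℝ) + 2) * γ - n) / 2) * (γ - 1))) :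
    ∃ Tstar : ℝ, 0 < Tstar ∧ ∀ T : ℝ, Tstar ≤ T →
      ¬ ∃ S : FullEulerSolution n γ cν s₁ T,
          (∀ x, s₁ ≤ S.s 0 x) ∧
          S.M 0 = M₀ ∧ S.P 0 = P₀ ∧ S.F 0 = F₀ ∧ S.G 0 = G₀ ∧ S.E 0 = E₀ := by
  set κ : ℝ := (n : ℝ) * (γ - 1) / 2 with hκ_def
  set N : ℝ := (((n : ℝ) + 2) * γ - n) / 2 with hN_def
  set W : ℝ := (Real.Gamma ((n : ℝ) / 2 + 1) / Real.pi ^ ((n : ℝ) / 2)) ^ (γ - 1) with hW_def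
  have hn0 : (0 : ℝ) < n := by exact_mod_cast hn
  have hκ : (n : ℝ) * (γ - 1) ≤ 2 := by
    have := (le_div_iff₀ hn0).1 (show γ - 1 ≤ 2 / n by linarith)
    linarith
  have hγ1 : 0 < γ - 1 := by linarith
  have hexp := Real.exp_pos (s₁ / cν)
  have hMN : 0 < M₀ ^ N := Real.rpow_pos_of_pos hM₀ N
  have h2N : (0 : ℝ) < 2 ^ N := Real.rpow_pos_of_pos two_pos N
  obtain ⟨E₁, hE₁cond, hE₁ : E₀ < E₁⟩ : ∃ E₁, E₁ ^ κ * (G₀ - F₀ + E₀)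
      / (Real.exp (s₁ / cν) * M₀ ^ N) < W / (2 ^ N * (γ - 1)) ∧ E₀ < E₁ := by
    have hcont : ContinuousAt (fun e : ℝ => e ^ κ * (G₀ - F₀ + E₀)
        / (Real.exp (s₁ / cν) * M₀ ^ N)) E₀ :=
      ((Real.continuousAt_rpow_const E₀ κ (Or.inl hE₀.ne')).mul_const _).div_const _
    have hev := (hcont.eventually (gt_mem_nhds hcond)).filter_mono
      (nhdsWithin_le_nhds (s := Set.Ioi E₀))
    exact (hev.and self_mem_nhdsWithin).exists
  have hE₁0 : 0 < E₁ := hE₀.trans hE₁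
  have hδ : 0 < E₁ - E₀ := sub_pos.2 hE₁
  set τ : ℝ := 1 + (|2 * E₁ - F₀| + |E₁ - G₀|) / (E₁ - E₀) with hτ_def
  have hτ1 : 1 ≤ τ := le_add_of_nonneg_right (by positivity)
  have hgrowth : G₀ + F₀ * τ + E₀ * τ ^ 2 ≤ E₁ * (τ + 1) ^ 2 := by
    have h1 : |2 * E₁ - F₀| + |E₁ - G₀| ≤ (E₁ - E₀) * τ := by
      rw [hτ_def, mul_add, mul_div_cancel₀ _ hδ.ne']
      linarith
    have h2 := mul_le_mul_of_nonneg_right h1 (zero_le_one.trans hτ1)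
    have h3 := mul_le_mul_of_nonneg_right (neg_abs_le (2 * E₁ - F₀)) (zero_le_one.trans hτ1)
    have h4 := mul_le_mul_of_nonneg_left hτ1 (abs_nonneg (E₁ - G₀))
    have h5 := neg_abs_le (E₁ - G₀)
    nlinarith
  refine ⟨τ, by linarith, fun T hT => ?_⟩
  rintro ⟨S, -, hM, -, hF, hG, hE⟩
  have ht : τ ∈ Set.Icc 0 T := ⟨by linarith, hT⟩
  have hτ0 : 0 < τ + 1 := by linarith
  obtain ⟨hρint, hρle⟩ := S.exp_mul_integral_rpow_le_Ei hγ hcν ht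
  have hMτ : ∫ x, S.ρ τ x = M₀ := (S.M_eq ht).trans hM
  have hGτ := S.G_le hγ hκ ht
  rw [hF, hG, hE] at hGτ
  have hmoment := moment_mul_rpow_le_integral_rpow (H := E₁ * (τ + 1) ^ 2) hn hγ hγn
    (S.ρ_nonneg τ ht) (S.int_ρ τ ht) (S.int_ρx2 τ ht) hρint (by rw [hMτ]; exact hM₀)
    (by positivity) (by
      have : (1 / 2 : ℝ) * ∫ x, S.ρ τ x * ‖x‖ ^ 2 ≤ E₁ * (τ + 1) ^ 2 := hGτ.trans hgrowth
      linarith)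
  rw [hMτ, ← hκ_def, ← hN_def, ← hW_def,
    Real.mul_rpow hE₁0.le (sq_nonneg _)] at hmoment
  set R : ℝ := ((τ + 1) ^ 2) ^ κ with hR_def
  have hR : 0 < R := Real.rpow_pos_of_pos (by positivity) κ
  have hEiJ : R * S.Ei τ ≤ G₀ - F₀ + E₀ := by
    have h1 := S.J_mul_rpow_le hγ hκ ht
    have h2 : S.J 0 = G₀ - F₀ + E₀ := by
      simp only [FullEulerSolution.J, hF, hG, hE]; ring
    have h3 : (τ + 1) ^ ((n : ℝ) * (γ - 1) - 2) * (τ + 1) ^ 2 = R := by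
      rw [hR_def, ← Real.rpow_natCast (τ + 1) 2, ← Real.rpow_mul hτ0.le, ← Real.rpow_add hτ0,
        hκ_def]
      congr 1
      push_cast
      ring
    have h4 := mul_le_mul_of_nonneg_left (S.sq_mul_Ei_le_J ht)
      (Real.rpow_nonneg hτ0.le ((n : ℝ) * (γ - 1) - 2))
    rw [← mul_assoc, h3] at h4
    linarith
  refine absurd hE₁cond (not_lt.2 ?_)
  rw [div_le_div_iff₀ (by positivity) (by positivity)]
  have hEκ : 0 < E₁ ^ κ := Real.rpow_pos_of_pos hE₁0 κ
  have hfinal : Real.exp (s₁ / cν) * (M₀ ^ N * W / 2 ^ N) ≤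
      (γ - 1) * (E₁ ^ κ * (G₀ - F₀ + E₀)) :=
    calc Real.exp (s₁ / cν) * (M₀ ^ N * W / 2 ^ N)
        ≤ Real.exp (s₁ / cν) * ((∫ x, S.ρ τ x ^ γ) * (E₁ ^ κ * R)) := by gcongr
      _ = Real.exp (s₁ / cν) * (∫ x, S.ρ τ x ^ γ) * (E₁ ^ κ * R) := by ring
      _ ≤ (γ - 1) * S.Ei τ * (E₁ ^ κ * R) := by gcongr
      _ = (γ - 1) * (E₁ ^ κ * (R * S.Ei τ)) := by ring
      _ ≤ (γ - 1) * (E₁ ^ κ * (G₀ - F₀ + E₀)) := by gcongr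
  calc W * (Real.exp (s₁ / cν) * M₀ ^ N)
      = Real.exp (s₁ / cν) * (M₀ ^ N * W / 2 ^ N) * 2 ^ N := by field_simp
    _ ≤ (γ - 1) * (E₁ ^ κ * (G₀ - F₀ + E₀)) * 2 ^ N := by gcongr
    _ = E₁ ^ κ * (G₀ - F₀ + E₀) * (2 ^ N * (γ - 1)) := by ring
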